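/- (Analyticity of the hard-edge matching factor E₁ at the origin, Proposition 5.5(i).) Let a > 0, α > −1 and δ ∈ (0,a). Let ψ be holomorphic on the disk {|z| < δ}, real-valued on (−δ,δ), with ψ(0) = 0 and ψ'(0) < 0. Define, for z in a sufficiently small punctured disk around 0 with z ∉ [0,δ), the 2×2 matrix E₁(z) := D_∞^{σ₃} · M(z) · (−z)^{ασ₃/2} · D(z)^{−σ₃} · U₀ · ψ(z)^{σ₃/4}, where all fractional powers are principal branches. Then E₁ extends to a holomorphic matrix-valued function on a full neighborhood of 0; in particular its singularity at 0 is removable and it has no jump across either (0,δ') or (−δ',0) for some δ' > 0. -/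

import Mathlib

/-- The exterior conformal map `d(z) = (2/a)z − 1 + (2/a) z^{1/2}(z−a)^{1/2}`,
with principal branches. -/
noncomputable def dmap (a : ℝ) (z : ℂ) : ℂ :=
  (2 / (a : ℂ)) * z - 1 + (2 / (a : ℂ)) * z ^ ((1 : ℂ) / 2) * (z - (a : ℂ)) ^ ((1 : ℂ) / 2)

/-- The constant matrix `U₀ = (1/√2)·[[1, i],[i, 1]]`. -/
noncomputable def Uzero : Matrix (Fin 2) (Fin 2) ℂ :=
  (((Real.sqrt 2 : ℝ) : ℂ))⁻¹ • !![1, Complex.I; Complex.I, 1]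

/-- `w^{γσ₃} = diag(w^γ, w^{−γ})`, with principal branch powers. -/
noncomputable def cpowS3 (w γ : ℂ) : Matrix (Fin 2) (Fin 2) ℂ :=
  !![w ^ γ, 0; 0, w ^ (-γ)]

/-- `M(z) = U₀ ((z−a)/z)^{σ₃/4} U₀⁻¹`. -/
noncomputable def Mmat (a : ℝ) (z : ℂ) : Matrix (Fin 2) (Fin 2) ℂ :=
  Uzero * cpowS3 ((z - (a : ℂ)) / z) (1 / 4) * Uzero⁻¹

/-- `D_∞ = 2^{−α} a^{α/2}`. -/
noncomputable def Dinf (a α : ℝ) : ℝ := (2 : ℝ) ^ (-α) * a ^ (α / 2)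

open Complex Filter Topology

/-- Two complex numbers lie in the same one of the open upper half plane, the open lower half
plane and the positive real axis. -/
def SameSide (u v : ℂ) : Prop :=
  (0 < u.im ∧ 0 < v.im) ∨ (u.im < 0 ∧ v.im < 0) ∨
    (u.im = 0 ∧ 0 < u.re ∧ v.im = 0 ∧ 0 < v.re)

theorem SameSide.ne_zero_left {u v : ℂ} (h : SameSide u v) : u ≠ 0 := by
  rintro rfl
  simp [SameSide] at h

theorem SameSide.symm {u v : ℂ} (h : SameSide u v) : SameSide v u := by
  unfold SameSide at *
  tauto

theorem SameSide.ne_zero_right {u v : ℂ} (h : SameSide u v) : v ≠ 0 :=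
  h.symm.ne_zero_left

theorem SameSide.log_div {u v : ℂ} (h : SameSide u v) : log (u / v) = log u - log v := by
  have hu := h.ne_zero_left
  have hv := h.ne_zero_right
  have huv : u / v = exp (log u - log v) := by rw [exp_sub, exp_log hu, exp_log hv]
  have hpi := Real.pi_pos
  have key : -Real.pi < arg u - arg v ∧ arg u - arg v ≤ Real.pi := by
    rcases h with ⟨h1, h2⟩ | ⟨h1, h2⟩ | ⟨h1, h2, h3, h4⟩
    · have := arg_nonneg_iff.2 h1.le
      have := arg_nonneg_iff.2 h2.le
      have := arg_le_pi u
      have := arg_lt_pi_iff.2 (Or.inr h2.ne')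
      constructor <;> linarith
    · have := arg_neg_iff.2 h1
      have := arg_neg_iff.2 h2
      have := neg_pi_lt_arg u
      have := neg_pi_lt_arg v
      constructor <;> linarith
    · have := arg_eq_zero_iff.2 ⟨h2.le, h1⟩
      have := arg_eq_zero_iff.2 ⟨h4.le, h3⟩
      constructor <;> linarith
  rw [huv, log_exp] <;> simp only [sub_im, log_im]
  exacts [key.1, key.2]

theorem SameSide.div_cpow {u v : ℂ} (h : SameSide u v) (γ : ℂ) :
    (u / v) ^ γ = u ^ γ / v ^ γ := by
  rw [cpow_def_of_ne_zero (div_ne_zero h.ne_zero_left h.ne_zero_right),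
    cpow_def_of_ne_zero h.ne_zero_left, cpow_def_of_ne_zero h.ne_zero_right, h.log_div,
    ← exp_sub, sub_mul]

theorem cpow_half_sq (w : ℂ) : (w ^ ((1 : ℂ) / 2)) ^ 2 = w := by
  simp

theorem cpow_half_re_pos {w : ℂ} (hw : w ∈ slitPlane) : 0 < (w ^ ((1 : ℂ) / 2)).re := by
  have h1 := arg_lt_pi_iff.2 (by
    rcases mem_slitPlane_iff.1 hw with h | h
    exacts [Or.inl h.le, Or.inr h] : 0 ≤ w.re ∨ w.im ≠ 0)
  have h2 := neg_pi_lt_arg w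
  rw [cpow_def_of_ne_zero (slitPlane_ne_zero hw), exp_re]
  refine mul_pos (Real.exp_pos _) (Real.cos_pos_of_mem_Ioo ?_)
  have : (log w * (1 / 2)).im = arg w / 2 := by
    rw [show (1 / 2 : ℂ) = ((1 / 2 : ℝ) : ℂ) by push_cast; rfl, im_mul_ofReal, log_im]
    ring
  rw [this]
  constructor <;> linarith

theorem two_mul_re_mul_im_cpow_half (w : ℂ) :
    2 * (w ^ ((1 : ℂ) / 2)).re * (w ^ ((1 : ℂ) / 2)).im = w.im := by
  conv_rhs => rw [← cpow_half_sq w]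
  rw [sq, mul_im]
  ring

theorem log_sq_of_re_pos {x : ℂ} (hx : 0 < x.re) : log (x ^ 2) = 2 * log x := by
  have h := abs_lt.1 (abs_arg_lt_pi_div_two_iff.2 (Or.inl hx))
  have hx0 : x ≠ 0 := by rintro rfl; simp at hx
  rw [show x ^ 2 = exp (2 * log x) by rw [two_mul, exp_add, exp_log hx0, sq], log_exp]
  · simp only [mul_im, log_im, re_ofNat, im_ofNat]; linarith
  · simp only [mul_im, log_im, re_ofNat, im_ofNat]; linarith

theorem log_eq_log_neg_add {z : ℂ} (hz : 0 < z.im) : log z = log (-z) + Real.pi * I := by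
  simp only [log, norm_neg, arg_neg_eq_arg_sub_pi_of_im_pos hz]
  push_cast
  ring

theorem log_eq_log_neg_sub {z : ℂ} (hz : z.im < 0) : log z = log (-z) - Real.pi * I := by
  simp only [log, norm_neg, arg_neg_eq_arg_add_pi_of_im_neg hz]
  push_cast
  ring

theorem SameSide.log_sub_log_neg {u v : ℂ} (h : SameSide u v) (hu : u.im ≠ 0) :
    log u - log (-u) = log v - log (-v) := by
  rcases h with ⟨h1, h2⟩ | ⟨h1, h2⟩ | ⟨h1, -⟩
  · rw [log_eq_log_neg_add h1, log_eq_log_neg_add h2]; ring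
  · rw [log_eq_log_neg_sub h1, log_eq_log_neg_sub h2]; ring
  · exact absurd h1 hu

theorem cpow_half_mul_cpow_half_sub {a : ℝ} {z : ℂ} (hz : z.im ≠ 0) :
    z ^ ((1 : ℂ) / 2) * (z - a) ^ ((1 : ℂ) / 2) =
      -((-z) ^ ((1 : ℂ) / 2) * (a - z) ^ ((1 : ℂ) / 2)) := by
  have h1 : z ≠ 0 := by rintro rfl; simp at hz
  have hi : (z - a).im = z.im := by simp
  have h2 : z - a ≠ 0 := by intro h; rw [h] at hi; simp at hi; exact hz hi.symm
  have h3 : (a : ℂ) - z ≠ 0 := by rwa [← neg_sub, neg_ne_zero]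
  rw [cpow_def_of_ne_zero h1, cpow_def_of_ne_zero h2, cpow_def_of_ne_zero h3,
    cpow_def_of_ne_zero (neg_ne_zero.2 h1), ← exp_add, ← exp_add]
  rcases lt_or_gt_of_ne hz with h | h
  · rw [log_eq_log_neg_sub h, log_eq_log_neg_sub (hi.trans_lt h), neg_sub,
      ← exp_sub_pi_mul_I]
    congr 1; ring
  · rw [log_eq_log_neg_add h, log_eq_log_neg_add (h.trans_eq hi.symm), neg_sub,
      ← exp_add_pi_mul_I]
    congr 1; ring

theorem neg_dmap_eq_sq {a : ℝ} (ha : 0 < a) {z : ℂ} (hz : z.im ≠ 0) :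
    -dmap a z =
      (((-z) ^ ((1 : ℂ) / 2) + (a - z) ^ ((1 : ℂ) / 2)) / (Real.sqrt a : ℝ)) ^ 2 := by
  have hs := cpow_half_sq (-z)
  have hr := cpow_half_sq ((a : ℂ) - z)
  have ha' : (a : ℂ) ≠ 0 := ofReal_ne_zero.2 ha.ne'
  have hq : ((Real.sqrt a : ℝ) : ℂ) ^ 2 = a := by
    rw [← ofReal_pow, Real.sq_sqrt ha.le]
  rw [dmap, mul_assoc _ (z ^ _), cpow_half_mul_cpow_half_sub hz, div_pow, hq]
  field_simp
  linear_combination -hs - hr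

theorem re_add_cpow_half_pos {a : ℝ} {z : ℂ} (h1 : -z ∈ slitPlane)
    (h2 : (a : ℂ) - z ∈ slitPlane) :
    0 < ((-z) ^ ((1 : ℂ) / 2) + (a - z) ^ ((1 : ℂ) / 2)).re := by
  rw [add_re]
  exact add_pos (cpow_half_re_pos h1) (cpow_half_re_pos h2)

theorem szego_eq_of_im_ne_zero {a : ℝ} (ha : 0 < a) {z : ℂ} (hz : z.im ≠ 0) (β : ℂ) :
    z ^ β / dmap a z ^ β = (-z) ^ β * exp (-(2 * β * log
      (((-z) ^ ((1 : ℂ) / 2) + (a - z) ^ ((1 : ℂ) / 2)) / (Real.sqrt a : ℝ)))) := by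
  have hq : 0 < Real.sqrt a := Real.sqrt_pos.2 ha
  have m1 : -z ∈ slitPlane := mem_slitPlane_iff.2 (Or.inr (by simpa using hz))
  have m2 : (a : ℂ) - z ∈ slitPlane := mem_slitPlane_iff.2 (Or.inr (by simpa using hz))
  have hd := neg_dmap_eq_sq ha hz
  set s := (-z) ^ ((1 : ℂ) / 2) with hs
  set r := ((a : ℂ) - z) ^ ((1 : ℂ) / 2) with hr
  have s1 : 0 < s.re := cpow_half_re_pos m1
  have r1 : 0 < r.re := cpow_half_re_pos m2
  have s2 := two_mul_re_mul_im_cpow_half (-z)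
  have r2 := two_mul_re_mul_im_cpow_half ((a : ℂ) - z)
  rw [← hs, neg_im] at s2
  rw [← hr, sub_im, ofReal_im, zero_sub] at r2
  set x := (s + r) / (Real.sqrt a : ℝ) with hx
  have x1 : x.re = (s.re + r.re) / Real.sqrt a := by rw [hx, div_ofReal_re, add_re]
  have x2 : x.im = (s.im + r.im) / Real.sqrt a := by rw [hx, div_ofReal_im, add_im]
  have xpos : 0 < x.re := by rw [x1]; positivity
  have dim : (dmap a z).im = -(2 * x.re * x.im) := by
    rw [← neg_neg (dmap a z), hd, neg_im, sq, mul_im]; ring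
  have hside : SameSide z (dmap a z) := by
    rcases lt_or_gt_of_ne hz with h | h
    · have : 0 < s.im := by by_contra!; nlinarith
      have : 0 < r.im := by by_contra!; nlinarith
      have : 0 < x.im := by rw [x2]; positivity
      exact Or.inr (Or.inl ⟨h, by rw [dim]; nlinarith [mul_pos xpos this]⟩)
    · have h1 : s.im < 0 := by by_contra!; nlinarith
      have h2 : r.im < 0 := by by_contra!; nlinarith
      have : x.im < 0 := by rw [x2]; exact div_neg_of_neg_of_pos (by linarith) hq
      exact Or.inl ⟨h, by rw [dim]; nlinarith [mul_neg_of_pos_of_neg xpos this]⟩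
  rw [cpow_def_of_ne_zero hside.ne_zero_left, cpow_def_of_ne_zero hside.ne_zero_right,
    cpow_def_of_ne_zero (neg_ne_zero.2 hside.ne_zero_left), ← exp_sub, ← exp_add]
  have h3 := hside.log_sub_log_neg hz
  rw [hd, log_sq_of_re_pos xpos] at h3
  congr 1
  linear_combination β * h3

theorem tendsto_cpow_half_zero : Tendsto (fun w : ℂ => w ^ ((1 : ℂ) / 2)) (𝓝 0) (𝓝 0) := by
  have h : ContinuousAt (fun w : ℂ => w ^ ((1 : ℂ) / 2)) 0 :=
    continuousAt_cpow_const_of_re_pos (by simp) (by simp)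
  simpa [ContinuousAt] using h

/-- An even holomorphic germ at `0` is a holomorphic function of the square of its variable. -/
theorem AnalyticAt.comp_cpow_half_of_even {F : ℂ → ℂ} (hF : AnalyticAt ℂ F 0)
    (he : ∀ᶠ s in 𝓝 0, F (-s) = F s) :
    AnalyticAt ℂ (fun w => F (w ^ ((1 : ℂ) / 2))) 0 := by
  have hneg : Tendsto (fun w : ℂ => I * (-w) ^ ((1 : ℂ) / 2)) (𝓝 0) (𝓝 0) := by
    have h : Tendsto (fun w : ℂ => -w) (𝓝 0) (𝓝 0) := by simpa using tendsto_neg (0 : ℂ)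
    simpa using (tendsto_cpow_half_zero.comp h).const_mul I
  have hd : ∀ᶠ s in 𝓝 0, DifferentiableAt ℂ F s :=
    analyticAt_iff_eventually_differentiableAt.1 hF
  refine analyticAt_of_differentiable_on_punctured_nhds_of_continuousAt ?_ ?_
  · have hE := eventually_eventually_nhds.2 (tendsto_cpow_half_zero.eventually he)
    filter_upwards [hE.filter_mono nhdsWithin_le_nhds,
      (tendsto_cpow_half_zero.eventually hd).filter_mono nhdsWithin_le_nhds,
      (hneg.eventually hd).filter_mono nhdsWithin_le_nhds, self_mem_nhdsWithin]
      with w hw hd1 hd2 hw0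
    rcases mem_slitPlane_or_neg_mem_slitPlane hw0 with hs | hs
    · exact hd1.comp w (differentiableAt_id.cpow_const hs)
    · have h2 : DifferentiableAt ℂ (fun w : ℂ => I * (-w) ^ ((1 : ℂ) / 2)) w :=
        (differentiableAt_id.neg.cpow_const hs).const_mul I
      refine (hd2.comp w h2).congr_of_eventuallyEq ?_
      filter_upwards [hw] with v hv
      have hsq : (I * (-v) ^ ((1 : ℂ) / 2)) ^ 2 = (v ^ ((1 : ℂ) / 2)) ^ 2 := by
        rw [mul_pow, cpow_half_sq, cpow_half_sq, I_sq]; ring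
      rcases sq_eq_sq_iff_eq_or_eq_neg.1 hsq with h | h
      · simp only [Function.comp_apply, h]
      · simp only [Function.comp_apply, h, hv]
  · have h0 : ((0 : ℂ) ^ ((1 : ℂ) / 2)) = 0 := by simp
    have hc : ContinuousAt (fun w : ℂ => w ^ ((1 : ℂ) / 2)) 0 := by
      rw [ContinuousAt, h0]; exact tendsto_cpow_half_zero
    exact ContinuousAt.comp (g := F) (by rw [h0]; exact hF.continuousAt) hc

theorem AnalyticAt.dslope_self {F : ℂ → ℂ} {z : ℂ} (hF : AnalyticAt ℂ F z) :
    AnalyticAt ℂ (dslope F z) z := by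
  obtain ⟨p, hp⟩ := hF
  exact ⟨_, hp.has_fpower_series_dslope_fslope⟩

/-- The function `s ↦ arsinh (s / √a)`. -/
noncomputable def scaledArsinh (a : ℝ) (s : ℂ) : ℂ :=
  log ((s + (a + s ^ 2) ^ ((1 : ℂ) / 2)) / (Real.sqrt a : ℝ))

theorem ofReal_cpow_half {a : ℝ} (ha : 0 < a) :
    (a : ℂ) ^ ((1 : ℂ) / 2) = (Real.sqrt a : ℝ) := by
  rw [Real.sqrt_eq_rpow, ofReal_cpow ha.le]
  norm_num

theorem analyticAt_scaledArsinh_arg {a : ℝ} (ha : 0 < a) :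
    AnalyticAt ℂ (fun s : ℂ => (s + (a + s ^ 2) ^ ((1 : ℂ) / 2)) / (Real.sqrt a : ℝ)) 0 := by
  have h : AnalyticAt ℂ (fun s : ℂ => ((a : ℂ) + s ^ 2) ^ ((1 : ℂ) / 2)) 0 :=
    AnalyticAt.cpow (by fun_prop) analyticAt_const (by simpa using ha)
  exact (analyticAt_id.add h).div_const

theorem scaledArsinh_arg_zero {a : ℝ} (ha : 0 < a) :
    ((0 : ℂ) + (a + 0 ^ 2) ^ ((1 : ℂ) / 2)) / (Real.sqrt a : ℝ) = 1 := by
  have hq : ((Real.sqrt a : ℝ) : ℂ) ≠ 0 := ofReal_ne_zero.2 (Real.sqrt_pos.2 ha).ne'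
  rw [zero_pow two_ne_zero, add_zero, zero_add, ofReal_cpow_half ha, div_self hq]

theorem scaledArsinh_zero {a : ℝ} (ha : 0 < a) : scaledArsinh a 0 = 0 := by
  rw [scaledArsinh, scaledArsinh_arg_zero ha, log_one]

theorem analyticAt_scaledArsinh {a : ℝ} (ha : 0 < a) : AnalyticAt ℂ (scaledArsinh a) 0 := by
  refine (analyticAt_scaledArsinh_arg ha).clog ?_
  rw [scaledArsinh_arg_zero ha]
  exact one_mem_slitPlane

theorem scaledArsinh_neg_eventually {a : ℝ} (ha : 0 < a) :
    ∀ᶠ s in 𝓝 0, scaledArsinh a (-s) = -scaledArsinh a s := by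
  have hmem := (analyticAt_scaledArsinh_arg ha).continuousAt.eventually_mem
    (isOpen_slitPlane.mem_nhds (by rw [scaledArsinh_arg_zero ha]; exact one_mem_slitPlane))
  filter_upwards [hmem] with s hs
  have hs0 := slitPlane_ne_zero hs
  have hq : ((Real.sqrt a : ℝ) : ℂ) ≠ 0 := ofReal_ne_zero.2 (Real.sqrt_pos.2 ha).ne'
  have hq2 : ((Real.sqrt a : ℝ) : ℂ) ^ 2 = a := by rw [← ofReal_pow, Real.sq_sqrt ha.le]
  rw [scaledArsinh, scaledArsinh, ← log_inv _ (mem_slitPlane_iff_arg.1 hs).1, neg_sq]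
  congr 1
  refine eq_inv_of_mul_eq_one_left ?_
  have hr := cpow_half_sq ((a : ℂ) + s ^ 2)
  rw [div_mul_div_comm, ← sq, hq2, div_eq_one_iff_eq (ofReal_ne_zero.2 ha.ne')]
  linear_combination hr

theorem szego_eq_of_neg_mem_slitPlane {a α : ℝ} (ha : 0 < a) {D : ℂ → ℂ}
    (hD : DifferentiableOn ℂ D {z : ℂ | ¬(z.im = 0 ∧ 0 ≤ z.re ∧ z.re ≤ a)})
    (hDeq : ∀ z : ℂ, ¬(z.im = 0 ∧ z.re ≤ a) →
      D z = z ^ ((α : ℂ) / 2) / (dmap a z) ^ ((α : ℂ) / 2))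
    {z : ℂ} (hz : -z ∈ slitPlane) :
    D z = (-z) ^ ((α : ℂ) / 2) * exp (-(α * scaledArsinh a ((-z) ^ ((1 : ℂ) / 2)))) := by
  have hoff : ∀ w : ℂ, w.im ≠ 0 → D w =
      (-w) ^ ((α : ℂ) / 2) * exp (-(α * scaledArsinh a ((-w) ^ ((1 : ℂ) / 2)))) := by
    intro w hw
    rw [hDeq w (fun h => hw h.1), szego_eq_of_im_ne_zero ha hw, scaledArsinh, cpow_half_sq,
      ← sub_eq_add_neg, mul_div_cancel₀ _ two_ne_zero]
  by_cases him : z.im = 0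
  swap
  · exact hoff z him
  have hre : z.re < 0 := by
    rcases mem_slitPlane_iff.1 hz with h | h
    · simpa using h
    · simp [him] at h
  have haz : (a : ℂ) - z ∈ slitPlane :=
    mem_slitPlane_iff.2 (Or.inl (by rw [sub_re, ofReal_re]; linarith))
  have hpath : Tendsto (fun t : ℝ => z + t * I) (𝓝[≠] 0) (𝓝[{w | w.im ≠ 0}] z) := by
    refine tendsto_nhdsWithin_iff.2 ⟨?_, ?_⟩
    · have : Continuous (fun t : ℝ => z + t * I) := by fun_prop
      simpa using (this.tendsto 0).mono_left nhdsWithin_le_nhds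
    · filter_upwards [self_mem_nhdsWithin] with t ht
      simpa [him] using ht
  have hne : (𝓝[{w : ℂ | w.im ≠ 0}] z).NeBot := hpath.neBot
  have hDc : Tendsto D (𝓝[{w | w.im ≠ 0}] z) (𝓝 (D z)) := by
    have h := (hD.continuousOn z (fun h => absurd h.2.1 hre.not_ge)).tendsto
    exact h.mono_left (nhdsWithin_mono z fun w hw h => hw h.1)
  have hc : ContinuousAt (fun w : ℂ => (-w) ^ ((α : ℂ) / 2) *
      exp (-(α * scaledArsinh a ((-w) ^ ((1 : ℂ) / 2))))) z := by
    have hs : ∀ γ : ℂ, ContinuousAt (fun w : ℂ => (-w) ^ γ) z := fun γ =>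
      continuousAt_id.neg.cpow continuousAt_const hz
    have hT : ContinuousAt (fun w : ℂ => scaledArsinh a ((-w) ^ ((1 : ℂ) / 2))) z := by
      simp only [scaledArsinh, cpow_half_sq, ← sub_eq_add_neg]
      refine ContinuousAt.clog (((hs _).add
        ((continuousAt_const.sub continuousAt_id).cpow continuousAt_const haz)).div_const _) ?_
      refine mem_slitPlane_iff.2 (Or.inl ?_)
      simp only [div_ofReal_re]
      exact div_pos (re_add_cpow_half_pos hz haz) (Real.sqrt_pos.2 ha)
    exact (hs _).mul (hT.const_mul _).neg.cexp
  refine tendsto_nhds_unique hDc ((hc.tendsto.mono_left nhdsWithin_le_nhds).congr' ?_)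
  filter_upwards [self_mem_nhdsWithin] with w hw using (hoff w hw).symm

theorem eq_neg_mul_neg_dslope {ψ : ℂ → ℂ} (hψ0 : ψ 0 = 0) (z : ℂ) :
    ψ z = -z * -dslope ψ 0 z := by
  have := sub_smul_dslope ψ 0 z
  rw [hψ0, smul_eq_mul] at this
  linear_combination -this

theorem sameSide_neg_eventually {ψ : ℂ → ℂ} {δ : ℝ} {c : ℂ} (hδ : 0 < δ)
    (hψ : AnalyticAt ℂ ψ 0) (hψreal : ∀ x : ℝ, |x| < δ → (ψ (x : ℂ)).im = 0)
    (hψ0 : ψ 0 = 0) (hc : HasDerivAt ψ c 0) (hcim : c.im = 0) (hcre : c.re < 0) :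
    ∀ᶠ z in 𝓝 0, -z ∈ slitPlane → SameSide (ψ z) (-z) := by
  have hstrict := hψ.hasStrictDerivAt
  rw [hc.deriv] at hstrict
  have hlin := hstrict.hasStrictFDerivAt.isLittleO.def (c := -c.re / 2) (by linarith)
  have hmap : Tendsto (fun z : ℂ => (z, (z.re : ℂ))) (𝓝 0) (𝓝 ((0 : ℂ), (0 : ℂ))) := by
    have : Continuous (fun z : ℂ => (z, (z.re : ℂ))) := by fun_prop
    simpa using this.tendsto 0
  have hg : ∀ᶠ z in 𝓝 0, (-dslope ψ 0 z).re > 0 := by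
    have h : ContinuousAt (fun z => (-dslope ψ 0 z).re) 0 :=
      continuous_re.continuousAt.comp hψ.dslope_self.continuousAt.neg
    refine h.eventually_const_lt ?_
    simpa [dslope_same, hc.deriv] using hcre
  filter_upwards [hmap.eventually hlin, hg, Metric.ball_mem_nhds (0 : ℂ) hδ]
    with z hz hgz hzδ hslit
  have hzre : |z.re| < δ := (abs_re_le_norm z).trans_lt (by simpa using hzδ)
  by_cases him : z.im = 0
  · have hre : z.re < 0 := by
      rcases mem_slitPlane_iff.1 hslit with h | h
      · simpa using h
      · simp [him] at h
    have hzeq : (z.re : ℂ) = z := Complex.ext rfl him.symm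
    refine Or.inr (Or.inr ⟨?_, ?_, by simpa using him, by simpa using hre⟩)
    · simpa [hzeq] using hψreal z.re hzre
    · rw [eq_neg_mul_neg_dslope hψ0 z, mul_re, neg_im z, him]
      simp only [neg_zero, zero_mul, sub_zero]
      exact mul_pos (by simpa using hre) hgz
  · have hsub : z - (z.re : ℂ) = z.im * I := by
      apply Complex.ext <;> simp
    simp only [ContinuousLinearMap.toSpanSingleton_apply, smul_eq_mul, hsub] at hz
    have h1 := (abs_im_le_norm _).trans hz
    simp only [sub_im, hψreal z.re hzre, mul_im, mul_re, ofReal_re, ofReal_im, I_re, I_im,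
      norm_mul, norm_I, norm_real, Real.norm_eq_abs, hcim] at h1
    ring_nf at h1
    have h2 := abs_le.1 h1
    rcases lt_or_gt_of_ne him with h | h
    · rw [abs_of_neg h] at h2
      refine Or.inl ⟨?_, by simpa using h⟩
      nlinarith [mul_pos_of_neg_of_neg hcre h]
    · rw [abs_of_pos h] at h2
      refine Or.inr (Or.inl ⟨?_, by simpa using h⟩)
      nlinarith [mul_neg_of_neg_of_pos hcre h]

theorem inv_sqrt_two_mul_self :
    (((Real.sqrt 2 : ℝ) : ℂ))⁻¹ * (((Real.sqrt 2 : ℝ) : ℂ))⁻¹ = 1 / 2 := by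
  rw [← mul_inv, ← ofReal_mul, Real.mul_self_sqrt zero_le_two]
  norm_num

theorem Uzero_inv :
    Uzero⁻¹ = (((Real.sqrt 2 : ℝ) : ℂ))⁻¹ • !![1, -I; -I, 1] := by
  refine Matrix.inv_eq_right_inv ?_
  rw [Uzero, Matrix.smul_mul, Matrix.mul_smul, smul_smul, inv_sqrt_two_mul_self]
  ext i j
  fin_cases i <;> fin_cases j <;> simp <;> norm_num

theorem Uzero_inv_mul_diag_mul_Uzero (x y : ℂ) :
    Uzero⁻¹ * !![x, 0; 0, y] * Uzero =
      !![(x + y) / 2, I * ((x - y) / 2); -I * ((x - y) / 2), (x + y) / 2] := by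
  rw [Uzero_inv, Uzero, Matrix.smul_mul, Matrix.smul_mul, Matrix.mul_smul, smul_smul,
    inv_sqrt_two_mul_self]
  ext i j
  fin_cases i <;> fin_cases j <;> simp <;> ring_nf <;>
    simp <;> ring

theorem Mmat_conjugation (L : Matrix (Fin 2) (Fin 2) ℂ) (p x y f : ℂ) :
    L * (Uzero * !![p, 0; 0, p⁻¹] * Uzero⁻¹) * !![x, 0; 0, y] * Uzero * !![f, 0; 0, f⁻¹] =
      L * Uzero * !![p * f * ((x + y) / 2), I * (p * f⁻¹ * ((x - y) / 2));
        -I * (p⁻¹ * f * ((x - y) / 2)), p⁻¹ * f⁻¹ * ((x + y) / 2)] := by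
  have h : L * (Uzero * !![p, 0; 0, p⁻¹] * Uzero⁻¹) * !![x, 0; 0, y] * Uzero * !![f, 0; 0, f⁻¹]
      = L * Uzero * (!![p, 0; 0, p⁻¹] * (Uzero⁻¹ * !![x, 0; 0, y] * Uzero) *
        !![f, 0; 0, f⁻¹]) := by
    simp only [Matrix.mul_assoc]
  rw [h, Uzero_inv_mul_diag_mul_Uzero]
  congr 1
  ext i j
  fin_cases i <;> fin_cases j <;> simp <;> ring

theorem cpowS3_eq (w γ : ℂ) : cpowS3 w γ = !![w ^ γ, 0; 0, (w ^ γ)⁻¹] := by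
  rw [cpowS3, cpow_neg]

theorem analyticAt_cosh_scaledArsinh {a : ℝ} (ha : 0 < a) (α : ℂ) :
    AnalyticAt ℂ (fun w => cosh (α * scaledArsinh a (w ^ ((1 : ℂ) / 2)))) 0 := by
  have h : AnalyticAt ℂ (fun s => cosh (α * scaledArsinh a s)) 0 :=
    (differentiable_cosh.analyticAt _).fun_comp (analyticAt_const.mul (analyticAt_scaledArsinh ha))
  refine h.comp_cpow_half_of_even ?_
  filter_upwards [scaledArsinh_neg_eventually ha] with s hs
  rw [hs, mul_neg, cosh_neg]

theorem analyticAt_dslope_sinh_scaledArsinh {a : ℝ} (ha : 0 < a) (α : ℂ) :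
    AnalyticAt ℂ (fun w => dslope (fun s => sinh (α * scaledArsinh a s)) 0
      (w ^ ((1 : ℂ) / 2))) 0 := by
  have h : AnalyticAt ℂ (fun s => sinh (α * scaledArsinh a s)) 0 :=
    (differentiable_sinh.analyticAt _).fun_comp (analyticAt_const.mul (analyticAt_scaledArsinh ha))
  refine h.dslope_self.comp_cpow_half_of_even ?_
  filter_upwards [scaledArsinh_neg_eventually ha] with s hs
  rcases eq_or_ne s 0 with rfl | h0
  · rw [neg_zero]
  · rw [dslope_of_ne _ h0, dslope_of_ne _ (neg_ne_zero.2 h0), slope_def_field, slope_def_field,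
      hs, scaledArsinh_zero ha, mul_neg, sinh_neg, mul_zero, sinh_zero, sub_zero, sub_zero,
      sub_zero, sub_zero, neg_div_neg_eq]

/-- Analyticity of the hard-edge matching factor `E₁` at the origin
(Proposition 5.5(i)):
`E₁(z) = D_∞^{σ₃} M(z) (−z)^{ασ₃/2} D(z)^{−σ₃} U₀ ψ(z)^{σ₃/4}` extends
holomorphically to a full neighborhood of `0`. -/
theorem statement17 (a α δ : ℝ) (ha : 0 < a) (hα : -1 < α) (hδ : 0 < δ) (hδa : δ < a)
    (D ψ : ℂ → ℂ)
    -- D is the Szegő function: holomorphic on ℂ∖[0,a], equal to z^{α/2}/d(z)^{α/2}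
    -- off (−∞,a]
    (hD : DifferentiableOn ℂ D {z : ℂ | ¬(z.im = 0 ∧ 0 ≤ z.re ∧ z.re ≤ a)})
    (hDeq : ∀ z : ℂ, ¬(z.im = 0 ∧ z.re ≤ a) →
      D z = z ^ ((α : ℂ) / 2) / (dmap a z) ^ ((α : ℂ) / 2))
    -- ψ is holomorphic near 0, real on (−δ,δ), with ψ(0) = 0 and ψ'(0) < 0
    (hψ : DifferentiableOn ℂ ψ (Metric.ball 0 δ))
    (hψreal : ∀ x : ℝ, |x| < δ → (ψ (x : ℂ)).im = 0)
    (hψ0 : ψ 0 = 0)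
    (hψ' : ∃ c : ℂ, HasDerivAt ψ c 0 ∧ c.im = 0 ∧ c.re < 0) :
    ∃ (δ' : ℝ) (E : ℂ → Matrix (Fin 2) (Fin 2) ℂ), 0 < δ' ∧ δ' < δ ∧
      (∀ i j : Fin 2, DifferentiableOn ℂ (fun z => E z i j) (Metric.ball 0 δ')) ∧
      ∀ z ∈ Metric.ball (0 : ℂ) δ', ¬(z.im = 0 ∧ 0 ≤ z.re) →
        E z = !![((Dinf a α : ℝ) : ℂ), 0; 0, (((Dinf a α : ℝ) : ℂ))⁻¹] * Mmat a z *
            cpowS3 (-z) ((α : ℂ) / 2) * !![(D z)⁻¹, 0; 0, D z] * Uzero *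
            cpowS3 (ψ z) (1 / 4) := by
  obtain ⟨c, hc, hcim, hcre⟩ := hψ'
  have hψa : AnalyticAt ℂ ψ 0 := hψ.analyticAt (Metric.ball_mem_nhds 0 hδ)
  set A : ℂ → ℂ := fun z => (a - z) ^ ((1 : ℂ) / 4) with hA
  set G : ℂ → ℂ := fun z => (-dslope ψ 0 z) ^ ((1 : ℂ) / 4) with hG
  set C : ℂ → ℂ := fun z => cosh (α * scaledArsinh a ((-z) ^ ((1 : ℂ) / 2))) with hC
  set S : ℂ → ℂ := fun z => dslope (fun s => sinh (α * scaledArsinh a s)) 0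
    ((-z) ^ ((1 : ℂ) / 2)) with hS
  have hg0 : -dslope ψ 0 0 ∈ slitPlane :=
    mem_slitPlane_iff.2 (Or.inl (by simpa [dslope_same, hc.deriv] using hcre))
  have ha0 : (a : ℂ) - 0 ∈ slitPlane := by simpa using ha
  have hAa : AnalyticAt ℂ A 0 := AnalyticAt.cpow (by fun_prop) analyticAt_const ha0
  have hGa : AnalyticAt ℂ G 0 := hψa.dslope_self.neg.cpow analyticAt_const hg0
  have hCa : AnalyticAt ℂ C 0 :=
    AnalyticAt.fun_comp (g := fun w => cosh (α * scaledArsinh a (w ^ ((1 : ℂ) / 2))))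
      (by rw [neg_zero]; exact analyticAt_cosh_scaledArsinh ha α) analyticAt_id.neg
  have hSa : AnalyticAt ℂ S 0 :=
    AnalyticAt.fun_comp (g := fun w => dslope (fun s => sinh (α * scaledArsinh a s)) 0
        (w ^ ((1 : ℂ) / 2)))
      (by rw [neg_zero]; exact analyticAt_dslope_sinh_scaledArsinh ha α) analyticAt_id.neg
  have hA0 : A 0 ≠ 0 := fun h => slitPlane_ne_zero ha0 ((cpow_eq_zero_iff _ _).1 h).1
  have hG0 : G 0 ≠ 0 := fun h => slitPlane_ne_zero hg0 ((cpow_eq_zero_iff _ _).1 h).1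
  set N : ℂ → Matrix (Fin 2) (Fin 2) ℂ := fun z =>
    !![A z * G z * C z, I * (A z / G z * S z);
      -I * (-z * (G z / A z) * S z), C z / (A z * G z)] with hN
  have hNa : ∀ i j, AnalyticAt ℂ (fun z => N z i j) 0 := by
    have h00 := (hAa.mul hGa).mul hCa
    have h01 := analyticAt_const (v := I) |>.mul ((hAa.div hGa hG0).mul hSa)
    have h10 := analyticAt_const (v := -I) |>.mul
      ((analyticAt_id.neg.mul (hGa.div hAa hA0)).mul hSa)
    have h11 := hCa.div (hAa.mul hGa) (mul_ne_zero hA0 hG0)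
    intro i j
    fin_cases i <;> fin_cases j
    exacts [h00, h01, h10, h11]
  set L : Matrix (Fin 2) (Fin 2) ℂ :=
    !![((Dinf a α : ℝ) : ℂ), 0; 0, (((Dinf a α : ℝ) : ℂ))⁻¹]
  have hEa : ∀ i j, AnalyticAt ℂ (fun z => (L * Uzero * N z) i j) 0 := by
    intro i j
    simp only [Matrix.mul_apply (M := L * Uzero), Fin.sum_univ_two]
    exact (analyticAt_const.mul (hNa 0 j)).add (analyticAt_const.mul (hNa 1 j))
  have hEd : ∀ᶠ z in 𝓝 0, ∀ i j, DifferentiableAt ℂ (fun z => (L * Uzero * N z) i j) z :=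
    eventually_all.2 fun i => eventually_all.2 fun j =>
      analyticAt_iff_eventually_differentiableAt.1 (hEa i j)
  obtain ⟨ε, hε, hball⟩ := Metric.eventually_nhds_iff_ball.1
    (((hEd.and (sameSide_neg_eventually hδ hψa hψreal hψ0 hc hcim hcre)).and
      (hAa.continuousAt.eventually_ne hA0)).and (hGa.continuousAt.eventually_ne hG0))
  refine ⟨min ε (δ / 2), fun z => L * Uzero * N z, lt_min hε (half_pos hδ),
    (min_le_right _ _).trans_lt (half_lt_self hδ), fun i j z hz => ?_, fun z hz hcut => ?_⟩
  · exact ((hball z (Metric.ball_subset_ball (min_le_left _ _) hz)).1.1.1 i j)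
      |>.differentiableWithinAt
  obtain ⟨⟨⟨-, hside⟩, hAz⟩, hGz⟩ := hball z (Metric.ball_subset_ball (min_le_left _ _) hz)
  have hslit : -z ∈ slitPlane := by
    rw [mem_slitPlane_iff, neg_re, neg_im, neg_ne_zero, Left.neg_pos_iff]
    by_contra! h
    exact hcut ⟨h.2, h.1⟩
  have hz0 : -z ≠ 0 := slitPlane_ne_zero hslit
  have hzside : SameSide ((a : ℂ) - z) (-z) := by
    simp only [SameSide, sub_im, sub_re, neg_im, neg_re, ofReal_im, ofReal_re, zero_sub]
    rcases lt_trichotomy (-z).im 0 with h | h | h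
    · exact Or.inr (Or.inl ⟨h, h⟩)
    · have h2 := (mem_slitPlane_iff.1 hslit).resolve_right (not_not.2 h)
      rw [neg_re] at h2
      exact Or.inr (Or.inr ⟨h, by linarith, h, h2⟩)
    · exact Or.inl ⟨h, h⟩
  set s := (-z) ^ ((1 : ℂ) / 2) with hs
  set q := (-z) ^ ((1 : ℂ) / 4) with hq
  have hq0 : q ≠ 0 := fun h => hz0 ((cpow_eq_zero_iff _ _).1 h).1
  have hqs : q ^ 2 = s := by
    rw [hq, hs, ← cpow_nat_mul]
    norm_num
  have hss : s ^ 2 = -z := cpow_half_sq _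
  have hp : ((z - a) / z) ^ ((1 : ℂ) / 4) = A z / q := by
    rw [← neg_div_neg_eq, neg_sub, hzside.div_cpow]
  have hf : ψ z ^ ((1 : ℂ) / 4) = q * G z := by
    have h := (hside hslit).div_cpow (1 / 4)
    rw [show ψ z / -z = -dslope ψ 0 z by
      rw [eq_neg_mul_neg_dslope hψ0 z, mul_div_cancel_left₀ _ hz0]] at h
    rw [hG]
    simp only
    rw [h, mul_div_cancel₀ _ hq0]
  have hsinh : sinh (α * scaledArsinh a s) = s * S z := by
    have h := sub_smul_dslope (fun s => sinh (α * scaledArsinh a s)) 0 s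
    simp only [scaledArsinh_zero ha, mul_zero, sinh_zero, sub_zero, smul_eq_mul] at h
    exact h.symm
  have hw0 : (-z) ^ ((α : ℂ) / 2) ≠ 0 := fun h => hz0 ((cpow_eq_zero_iff _ _).1 h).1
  have hmid : cpowS3 (-z) ((α : ℂ) / 2) * !![(D z)⁻¹, 0; 0, D z] =
      !![exp (α * scaledArsinh a s), 0; 0, exp (-(α * scaledArsinh a s))] := by
    rw [cpowS3_eq, szego_eq_of_neg_mem_slitPlane ha hD hDeq hslit, ← hs, Matrix.mul_fin_two,
      mul_inv, mul_inv_cancel_left₀ hw0, inv_mul_cancel_left₀ hw0, ← exp_neg, neg_neg]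
    simp
  rw [Mmat, Matrix.mul_assoc _ (cpowS3 (-z) _), hmid, cpowS3_eq, cpowS3_eq, hp, hf,
    Mmat_conjugation]
  change L * Uzero * N z = L * Uzero * !![_ * cosh (α * scaledArsinh a s),
    I * (_ * sinh (α * scaledArsinh a s)); -I * (_ * sinh (α * scaledArsinh a s)),
    _ * cosh (α * scaledArsinh a s)]
  have e00 : A z * G z = A z / q * (q * G z) := by field_simp
  have e01 : A z / G z * S z = A z / q * (q * G z)⁻¹ * (s * S z) := by
    rw [← hqs]; field_simp
  have e10 : -z * (G z / A z) * S z = (A z / q)⁻¹ * (q * G z) * (s * S z) := by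
    rw [← hss, ← hqs]; field_simp
  have e11 : C z / (A z * G z) = (A z / q)⁻¹ * (q * G z)⁻¹ * C z := by field_simp
  rw [hsinh, ← e00, ← e01, ← e10]
  simp only [hN]
  rw [e11]
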